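/- arXiv:1605.07910 — 4 statements merged into one kernel-verified Lean document; each statement's English description precedes it below -/
import Mathlib

section
/- (Theorem 1(a), Decomposition.) Assume SYSTEM is feasible, let (qᵇ*, qᵖ*, (r_s*)) be an optimal solution of SYSTEM, and suppose multipliers (ξ̲, ξ̄, (ν̲_s, ν̄_s, μ̲_s, μ̄_s, λ_s)_{s∈S}) satisfy the KKT system of SYSTEM at it. If δ_n = Σ_{s∈S} p_s·(π_n(λ_s, μ̲_s, μ̄_s) − π_n(λ₁, μ̲₁, μ̄₁)) for every node n, then SYSTEM is optimally decomposed into ED–FR for this δ: a tuple (qᵇ, qᵖ, (r_s)) with r_1 = 0 is an optimal solution of SYSTEM if and only if (qᵇ, qᵖ) is an optimal solution of ED(d_1) and, for every s ∈ S, r_s is an optimal solution of FR(qᵇ, qᵖ, d_s). -/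
open Matrix Finset

noncomputable section

/-- Data of the power network: oriented incidence matrix `C`, positive line
susceptances `Bd`, line limits `f`, capacity bounds for dispatch (`qlb ≤ qub`)
and regulation (`plb ≤ pub`) generators, and cost functions `cb`, `cp` with
derivatives `cb'`, `cp'`. -/
structure PowerNet (N L : ℕ) where
  C : Matrix (Fin N) (Fin L) ℝ
  Bd : Fin L → ℝ
  f : Fin L → ℝ
  qlb : Fin N → ℝ
  qub : Fin N → ℝ
  plb : Fin N → ℝ
  pub : Fin N → ℝ
  cb : Fin N → ℝ → ℝ
  cp : Fin N → ℝ → ℝ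
  cb' : Fin N → ℝ → ℝ
  cp' : Fin N → ℝ → ℝ

namespace PowerNet

variable {N L : ℕ} (P : PowerNet N L)

/-- The weighted Laplacian `Lap = C·B·Cᵀ`. -/
def Lap : Matrix (Fin N) (Fin N) ℝ := P.C * Matrix.diagonal P.Bd * P.Cᵀ

/-- The shift-factor matrix `H = B·Cᵀ·(Lap + (1/N)·𝟙𝟙ᵀ)⁻¹`. -/
def H : Matrix (Fin L) (Fin N) ℝ :=
  Matrix.diagonal P.Bd * P.Cᵀ *
    (P.Lap + (N : ℝ)⁻¹ • Matrix.of (fun _ _ : Fin N => (1 : ℝ)))⁻¹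

/-- Standing assumptions: `N ≥ 1`; positive susceptances; connectivity (the
kernel of `Cᵀ` is spanned by the all-ones vector); ordered capacity bounds;
cost functions continuously differentiable (with the indicated derivatives)
and strictly convex. -/
def Sane : Prop :=
  1 ≤ N ∧
  (∀ l, 0 < P.Bd l) ∧
  (∀ x : Fin N → ℝ, P.Cᵀ.mulVec x = 0 → ∃ c : ℝ, x = fun _ => c) ∧
  (∀ n, P.qlb n ≤ P.qub n) ∧ (∀ n, P.plb n ≤ P.pub n) ∧
  (∀ n x, HasDerivAt (P.cb n) (P.cb' n x) x) ∧
  (∀ n x, HasDerivAt (P.cp n) (P.cp' n x) x) ∧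
  (∀ n, Continuous (P.cb' n)) ∧ (∀ n, Continuous (P.cp' n)) ∧
  (∀ n, StrictConvexOn ℝ Set.univ (P.cb n)) ∧
  (∀ n, StrictConvexOn ℝ Set.univ (P.cp n))

/-- Nodal injections `qᵇ + qᵖ + r − d`. -/
def inj (_P : PowerNet N L) (qb qp r d : Fin N → ℝ) : Fin N → ℝ :=
  fun n => qb n + qp n + r n - d n

/-- The feasible set `Ω(d)`: capacity constraints, supply-demand balance
`𝟙ᵀ(qᵇ+qᵖ+r−d) = 0`, and line limits `−f ≤ H(qᵇ+qᵖ+r−d) ≤ f`. -/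
def Omega (d qb qp r : Fin N → ℝ) : Prop :=
  (∀ n, P.qlb n ≤ qb n ∧ qb n ≤ P.qub n) ∧
  (∀ n, P.plb n ≤ qp n + r n ∧ qp n + r n ≤ P.pub n) ∧
  (∑ n, (qb n + qp n + r n - d n) = 0) ∧
  (∀ l, -P.f l ≤ P.H.mulVec (P.inj qb qp r d) l ∧
        P.H.mulVec (P.inj qb qp r d) l ≤ P.f l)

/-- Nodal prices `π(λ,μ̲,μ̄) = λ·𝟙 + Hᵀ(μ̲ − μ̄)`. -/
def price (lam : ℝ) (μl μu : Fin L → ℝ) (n : Fin N) : ℝ :=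
  lam + P.Hᵀ.mulVec (μl - μu) n

variable {S : Type} [Fintype S]

/-- The SYSTEM objective `∑_s p_s ∑_n (cᵇ(qᵇ) + cᵖ(qᵖ + r_s))`. -/
def sysCost (p : S → ℝ) (qb qp : Fin N → ℝ) (r : S → Fin N → ℝ) : ℝ :=
  ∑ s, p s * ∑ n, (P.cb n (qb n) + P.cp n (qp n + r s n))

/-- Feasibility for SYSTEM: `(qᵇ,qᵖ,r_s) ∈ Ω(d_s)` for all `s`, and `r_1 = 0`. -/
def SysFeas (s1 : S) (d : S → Fin N → ℝ)
    (qb qp : Fin N → ℝ) (r : S → Fin N → ℝ) : Prop :=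
  (∀ s, P.Omega (d s) qb qp (r s)) ∧ r s1 = 0

/-- Optimality for SYSTEM. -/
def SysOpt (s1 : S) (p : S → ℝ) (d : S → Fin N → ℝ)
    (qb qp : Fin N → ℝ) (r : S → Fin N → ℝ) : Prop :=
  P.SysFeas s1 d qb qp r ∧
  ∀ qb' qp' r', P.SysFeas s1 d qb' qp' r' →
    P.sysCost p qb qp r ≤ P.sysCost p qb' qp' r'

/-- The ED objective `∑_n (K·cᵇ(qᵇ) + K·cᵖ(qᵖ) − δ·qᵇ)`. -/
def edCost (K : ℕ) (δ qb qp : Fin N → ℝ) : ℝ :=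
  ∑ n, ((K : ℝ) * P.cb n (qb n) + (K : ℝ) * P.cp n (qp n) - δ n * qb n)

/-- Optimality for `ED(d₁)`. -/
def EDOpt (K : ℕ) (δ d1 qb qp : Fin N → ℝ) : Prop :=
  P.Omega d1 qb qp 0 ∧
  ∀ qb' qp', P.Omega d1 qb' qp' 0 → P.edCost K δ qb qp ≤ P.edCost K δ qb' qp'

/-- The FR objective `∑_n cᵖ(qᵖ + r)`. -/
def frCost (qp r : Fin N → ℝ) : ℝ := ∑ n, P.cp n (qp n + r n)

/-- Optimality for `FR(qᵇ,qᵖ,d_s)`. -/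
def FROpt (ds qb qp r : Fin N → ℝ) : Prop :=
  P.Omega ds qb qp r ∧
  ∀ r', P.Omega ds qb qp r' → P.frCost qp r ≤ P.frCost qp r'

/-- The KKT system of SYSTEM at a feasible point, with multipliers
`ξ̲, ξ̄` (dispatch capacities), `ν̲_s, ν̄_s` (regulation capacities),
`μ̲_s, μ̄_s` (line limits), `λ_s` (power balance). -/
def SystemKKT (K : ℕ) (p : S → ℝ) (d : S → Fin N → ℝ)
    (qb qp : Fin N → ℝ) (r : S → Fin N → ℝ)
    (ξl ξu : Fin N → ℝ) (νl νu : S → Fin N → ℝ)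
    (μl μu : S → Fin L → ℝ) (lam : S → ℝ) : Prop :=
  (∀ n, 0 ≤ ξl n) ∧ (∀ n, 0 ≤ ξu n) ∧
  (∀ s n, 0 ≤ νl s n) ∧ (∀ s n, 0 ≤ νu s n) ∧
  (∀ s l, 0 ≤ μl s l) ∧ (∀ s l, 0 ≤ μu s l) ∧
  (∀ n, (K : ℝ) * P.cb' n (qb n) + ξu n - ξl n
      = ∑ s, p s * P.price (lam s) (μl s) (μu s) n) ∧
  (∑ n, (ξl n * (P.qlb n - qb n) + ξu n * (qb n - P.qub n)) = 0) ∧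
  (∀ s n, P.cp' n (qp n + r s n) + νu s n - νl s n
      = P.price (lam s) (μl s) (μu s) n) ∧
  (∀ s, ∑ n, (νl s n * (P.plb n - (qp n + r s n))
            + νu s n * ((qp n + r s n) - P.pub n)) = 0) ∧
  (∀ s, ∑ l, (μl s l * (-P.f l - P.H.mulVec (P.inj qb qp (r s) (d s)) l)
            + μu s l * (P.H.mulVec (P.inj qb qp (r s) (d s)) l - P.f l)) = 0)

end PowerNet

/-- A strictly convex function lies strictly above its tangent lines. -/
theorem StrictConvexOn.tangent_lt {c : ℝ → ℝ} (hc : StrictConvexOn ℝ Set.univ c) {x y m : ℝ}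
    (hm : HasDerivAt c m x) (hxy : y ≠ x) : m * (y - x) < c y - c x := by
  rcases lt_or_gt_of_ne hxy with h | h
  · have := hc.slope_lt_of_hasDerivAt (Set.mem_univ _) (Set.mem_univ _) h hm
    rw [slope_def_field, div_lt_iff₀ (sub_pos.2 h)] at this
    linarith
  · have := hc.lt_slope_of_hasDerivAt (Set.mem_univ _) (Set.mem_univ _) h hm
    rwa [slope_def_field, lt_div_iff₀ (sub_pos.2 h)] at this

/-- Multipliers of box constraints that satisfy complementary slackness at `x` define a linear
form which is minimized over the box at `x`. -/
theorem sum_multiplier_mul_sub_nonneg {ι : Type*} [Fintype ι] {lo hi a b x y : ι → ℝ}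
    (ha : ∀ i, 0 ≤ a i) (hb : ∀ i, 0 ≤ b i) (hy : ∀ i, lo i ≤ y i ∧ y i ≤ hi i)
    (hcs : ∑ i, (a i * (lo i - x i) + b i * (x i - hi i)) = 0) :
    0 ≤ ∑ i, (a i - b i) * (y i - x i) := by
  have h : ∑ i, (a i - b i) * (y i - x i) = ∑ i, (a i * (y i - lo i) + b i * (hi i - y i)) := by
    rw [← sub_eq_zero, ← Finset.sum_sub_distrib, ← hcs]
    exact Finset.sum_congr rfl fun i _ => by ring
  rw [h]
  exact Finset.sum_nonneg fun i _ => add_nonneg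
    (mul_nonneg (ha i) (sub_nonneg.2 (hy i).1)) (mul_nonneg (hb i) (sub_nonneg.2 (hy i).2))

/-- If `x` satisfies the stationarity and complementary slackness conditions of a strictly convex
separable problem over a box with prices `g`, then moving to any other point of the box costs
strictly more than its value at the prices `g`. -/
theorem sum_price_mul_sub_lt {ι : Type*} [Fintype ι] {c c' : ι → ℝ → ℝ} {w : ℝ} (hw : 0 < w)
    (hc : ∀ i, StrictConvexOn ℝ Set.univ (c i)) (hc' : ∀ i x, HasDerivAt (c i) (c' i x) x)
    {lo hi a b g x y : ι → ℝ} (ha : ∀ i, 0 ≤ a i) (hb : ∀ i, 0 ≤ b i)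
    (hy : ∀ i, lo i ≤ y i ∧ y i ≤ hi i)
    (hg : ∀ i, w * c' i (x i) + b i - a i = g i)
    (hcs : ∑ i, (a i * (lo i - x i) + b i * (x i - hi i)) = 0) (hxy : y ≠ x) :
    ∑ i, g i * (y i - x i) < w * (∑ i, c i (y i) - ∑ i, c i (x i)) := by
  have h₁ := sum_multiplier_mul_sub_nonneg ha hb hy hcs
  have h₂ : ∑ i, c' i (x i) * (y i - x i) < ∑ i, (c i (y i) - c i (x i)) := by
    obtain ⟨j, hj⟩ := Function.ne_iff.1 hxy
    refine Finset.sum_lt_sum (fun i _ => ?_)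
      ⟨j, Finset.mem_univ j, (hc j).tangent_lt (hc' j _) hj⟩
    rcases eq_or_ne (y i) (x i) with h | h
    · simp [h]
    · exact ((hc i).tangent_lt (hc' i _) h).le
  rw [Finset.sum_sub_distrib] at h₂
  have h₃ : ∑ i, g i * (y i - x i) =
      w * ∑ i, c' i (x i) * (y i - x i) - ∑ i, (a i - b i) * (y i - x i) := by
    rw [Finset.mul_sum, ← Finset.sum_sub_distrib]
    exact Finset.sum_congr rfl fun i _ => by rw [← hg i]; ring
  rw [h₃]
  linarith [mul_lt_mul_of_pos_left h₂ hw]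

namespace PowerNet

variable {N L : ℕ} (P : PowerNet N L)

/-- At nodal prices whose line multipliers satisfy complementary slackness at one dispatch, any
feasible dispatch for the same demand injects at least as much value. -/
theorem sum_price_mul_sub_nonneg {d qb qp r qbs qps rs : Fin N → ℝ} {lam : ℝ} {μl μu : Fin L → ℝ}
    (hl : ∀ l, 0 ≤ μl l) (hu : ∀ l, 0 ≤ μu l)
    (h : P.Omega d qb qp r) (hs : P.Omega d qbs qps rs)
    (hcs : ∑ l, (μl l * (-P.f l - P.H.mulVec (P.inj qbs qps rs d) l)
      + μu l * (P.H.mulVec (P.inj qbs qps rs d) l - P.f l)) = 0) :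
    0 ≤ ∑ n, P.price lam μl μu n * (qb n - qbs n)
      + ∑ n, P.price lam μl μu n * ((qp n + r n) - (qps n + rs n)) := by
  have h₁ := sum_multiplier_mul_sub_nonneg hl hu h.2.2.2 hcs
  set x := P.inj qb qp r d with hx
  set xs := P.inj qbs qps rs d with hxs
  have h₂ : ∑ l, (μl l - μu l) * (P.H.mulVec x l - P.H.mulVec xs l)
      = ∑ n, P.Hᵀ.mulVec (μl - μu) n * (x n - xs n) := by
    have : (μl - μu) ⬝ᵥ P.H.mulVec (x - xs) = P.Hᵀ.mulVec (μl - μu) ⬝ᵥ (x - xs) := by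
      rw [Matrix.dotProduct_mulVec, Matrix.mulVec_transpose]
    rw [Matrix.mulVec_sub] at this
    exact this
  have h₃ : ∑ n, lam * (x n - xs n) = 0 := by
    have e : ∑ n, x n = 0 := h.2.2.1
    have es : ∑ n, xs n = 0 := hs.2.2.1
    rw [← Finset.mul_sum, Finset.sum_sub_distrib, e, es]
    ring
  have h₄ := add_nonneg h₃.ge (h₁.trans_eq h₂)
  rw [← Finset.sum_add_distrib] at h₄ ⊢
  refine h₄.trans_eq (Finset.sum_congr rfl fun n _ => ?_)
  simp only [hx, hxs, inj, price]
  ring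

theorem sysCost_eq {S : Type} [Fintype S] {K : ℝ} {p : S → ℝ} (hpsum : ∑ s, p s = K)
    (qb qp : Fin N → ℝ) (r : S → Fin N → ℝ) :
    P.sysCost p qb qp r = K * ∑ n, P.cb n (qb n) + ∑ s, p s * P.frCost qp (r s) := by
  simp only [sysCost, frCost, Finset.sum_add_distrib, mul_add, ← Finset.sum_mul, hpsum]

theorem edCost_eq (K : ℕ) (δ qb qp : Fin N → ℝ) :
    P.edCost K δ qb qp
      = K * ∑ n, P.cb n (qb n) + K * P.frCost qp 0 - ∑ n, δ n * qb n := by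
  simp [edCost, frCost, Finset.sum_add_distrib, Finset.sum_sub_distrib, Finset.mul_sum]

end PowerNet

/-- **Theorem 1(a), Decomposition.** If SYSTEM is feasible,
`(qᵇ*, qᵖ*, r*)` is optimal for SYSTEM with KKT multipliers, and
`δ_n = ∑_s p_s (π_n(λ_s,μ̲_s,μ̄_s) − π_n(λ₁,μ̲₁,μ̄₁))` for every node `n`, then
SYSTEM is optimally decomposed into ED–FR: a tuple `(qᵇ,qᵖ,(r_s))` with
`r_1 = 0` is optimal for SYSTEM iff `(qᵇ,qᵖ)` is optimal for `ED(d₁)` and each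
`r_s` is optimal for `FR(qᵇ,qᵖ,d_s)`. -/
theorem decomposition_theorem_a
    {N L : ℕ} (P : PowerNet N L) (hP : P.Sane)
    {S : Type} [Fintype S] (s1 : S)
    (K : ℕ) (hK : 1 ≤ K)
    (p : S → ℝ) (hp : ∀ s, 0 < p s) (hpsum : ∑ s, p s = (K : ℝ)) (hp1 : p s1 = 1)
    (d : S → Fin N → ℝ)
    (qbs qps : Fin N → ℝ) (rs : S → Fin N → ℝ)
    (hopt : P.SysOpt s1 p d qbs qps rs)
    (ξl ξu : Fin N → ℝ) (νl νu : S → Fin N → ℝ)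
    (μl μu : S → Fin L → ℝ) (lam : S → ℝ)
    (hkkt : P.SystemKKT K p d qbs qps rs ξl ξu νl νu μl μu lam)
    (δ : Fin N → ℝ)
    (hδ : ∀ n, δ n = ∑ s, p s * (P.price (lam s) (μl s) (μu s) n
                               - P.price (lam s1) (μl s1) (μu s1) n)) :
    ∀ (qb qp : Fin N → ℝ) (r : S → Fin N → ℝ), r s1 = 0 →
      (P.SysOpt s1 p d qb qp r ↔
        (P.EDOpt K δ (d s1) qb qp ∧ ∀ s, P.FROpt (d s) qb qp (r s))) := by
  obtain ⟨-, -, -, -, -, hcb', hcp', -, -, hcb, hcp⟩ := hP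
  obtain ⟨hξl, hξu, hνl, hνu, hμl, hμu, hstb, hcsb, hstp, hcsp, hcsl⟩ := hkkt
  obtain ⟨⟨hfeas, hrs1⟩, hmin⟩ := id hopt
  have hK0 : (0 : ℝ) < K := by exact_mod_cast hK
  set π : S → Fin N → ℝ := fun s => P.price (lam s) (μl s) (μu s) with hπ
  have hbase_lt : ∀ qb : Fin N → ℝ, (∀ n, P.qlb n ≤ qb n ∧ qb n ≤ P.qub n) → qb ≠ qbs →
      ∑ n, (∑ s, p s * π s n) * (qb n - qbs n)
        < K * (∑ n, P.cb n (qb n) - ∑ n, P.cb n (qbs n)) :=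
    fun qb hqb hne => sum_price_mul_sub_lt hK0 hcb hcb' hξl hξu hqb hstb hcsb hne
  have hbase_le : ∀ qb : Fin N → ℝ, (∀ n, P.qlb n ≤ qb n ∧ qb n ≤ P.qub n) →
      ∑ n, (∑ s, p s * π s n) * (qb n - qbs n)
        ≤ K * (∑ n, P.cb n (qb n) - ∑ n, P.cb n (qbs n)) := by
    intro qb hqb
    rcases eq_or_ne qb qbs with rfl | hne
    · simp
    · exact (hbase_lt qb hqb hne).le
  have hreg_lt : ∀ s (qp r : Fin N → ℝ), (∀ n, P.plb n ≤ qp n + r n ∧ qp n + r n ≤ P.pub n) →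
      qp + r ≠ qps + rs s →
      ∑ n, π s n * ((qp n + r n) - (qps n + rs s n)) < P.frCost qp r - P.frCost qps (rs s) := by
    intro s qp r hq hne
    have := sum_price_mul_sub_lt (y := qp + r) (x := qps + rs s) (g := π s) one_pos hcp hcp'
      (hνl s) (hνu s) hq (fun n => by simpa using hstp s n) (hcsp s) hne
    rwa [one_mul] at this
  have hreg_le : ∀ s (qp r : Fin N → ℝ), (∀ n, P.plb n ≤ qp n + r n ∧ qp n + r n ≤ P.pub n) →
      ∑ n, π s n * ((qp n + r n) - (qps n + rs s n)) ≤ P.frCost qp r - P.frCost qps (rs s) := by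
    intro s qp r hq
    rcases eq_or_ne (qp + r) (qps + rs s) with heq | hne
    · have hn : ∀ n, qp n + r n = qps n + rs s n := fun n => congrFun heq n
      simp [PowerNet.frCost, hn]
    · exact (hreg_lt s qp r hq hne).le
  have hprice : ∀ s (qb qp r : Fin N → ℝ), P.Omega (d s) qb qp r →
      0 ≤ ∑ n, π s n * (qb n - qbs n) + ∑ n, π s n * ((qp n + r n) - (qps n + rs s n)) :=
    fun s qb qp r h => P.sum_price_mul_sub_nonneg (hμl s) (hμu s) h (hfeas s) (hcsl s)
  have hswap : ∀ qb : Fin N → ℝ, ∑ n, (∑ s, p s * π s n) * (qb n - qbs n)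
      = ∑ s, p s * ∑ n, π s n * (qb n - qbs n) := by
    intro qb
    simp only [Finset.sum_mul, Finset.mul_sum]
    rw [Finset.sum_comm]
    simp only [mul_assoc]
  have hδ' : ∀ qb : Fin N → ℝ, ∑ n, δ n * qb n - ∑ n, δ n * qbs n
      = ∑ n, (∑ s, p s * π s n) * (qb n - qbs n) - K * ∑ n, π s1 n * (qb n - qbs n) := by
    intro qb
    rw [Finset.mul_sum, ← Finset.sum_sub_distrib, ← Finset.sum_sub_distrib]
    refine Finset.sum_congr rfl fun n _ => ?_
    have : δ n = ∑ s, p s * π s n - K * π s1 n := by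
      rw [hδ n, ← hpsum, Finset.sum_mul, ← Finset.sum_sub_distrib]
      exact Finset.sum_congr rfl fun s _ => by ring
    rw [this]
    ring
  have hfrOpt : ∀ s, P.FROpt (d s) qbs qps (rs s) := by
    refine fun s => ⟨hfeas s, fun r' hr' => ?_⟩
    have h₁ := hprice s qbs qps r' hr'
    have h₂ := hreg_le s qps r' hr'.2.1
    simp only [sub_self, mul_zero, Finset.sum_const_zero, zero_add] at h₁
    linarith
  have hfrUnique : ∀ s r', P.FROpt (d s) qbs qps r' → r' = rs s := by
    rintro s r' ⟨hr', hle⟩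
    by_contra hne
    have h₁ := hprice s qbs qps r' hr'
    have h₂ := hreg_lt s qps r' hr'.2.1 (fun h => hne (add_left_cancel h))
    have h₃ := hle _ (hfeas s)
    simp only [sub_self, mul_zero, Finset.sum_const_zero, zero_add] at h₁
    linarith
  have hfeas1 : P.Omega (d s1) qbs qps 0 := hrs1 ▸ hfeas s1
  have hedOpt : P.EDOpt K δ (d s1) qbs qps := by
    refine ⟨hfeas1, fun qb qp h => ?_⟩
    have h₁ := mul_nonneg hK0.le (hprice s1 qb qp 0 h)
    have h₂ := mul_le_mul_of_nonneg_left (hreg_le s1 qp 0 h.2.1) hK0.le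
    have h₃ := hbase_le qb h.1
    have h₄ := hδ' qb
    rw [hrs1] at h₁ h₂
    rw [P.edCost_eq, P.edCost_eq]
    linarith
  have hedUnique : ∀ qb qp, P.EDOpt K δ (d s1) qb qp → qb = qbs ∧ qp = qps := by
    rintro qb qp ⟨h, hle⟩
    have h₁ := mul_nonneg hK0.le (hprice s1 qb qp 0 h)
    have h₂ := mul_le_mul_of_nonneg_left (hreg_le s1 qp 0 h.2.1) hK0.le
    have h₃ := hbase_le qb h.1
    have h₄ := hδ' qb
    have h₅ := hle _ _ hfeas1
    rw [P.edCost_eq, P.edCost_eq] at h₅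
    rw [hrs1] at h₁ h₂
    constructor <;> by_contra hne
    · have := hbase_lt qb h.1 hne
      linarith
    · have := mul_lt_mul_of_pos_left
        (hreg_lt s1 qp 0 h.2.1 (by rw [hrs1, add_zero, add_zero]; exact hne)) hK0
      rw [hrs1] at this
      linarith
  have hsysUnique : ∀ qb qp r, P.SysOpt s1 p d qb qp r → qb = qbs ∧ qp = qps ∧ r = rs := by
    rintro qb qp r ⟨⟨h, hr1⟩, hle⟩
    have h₁ : 0 ≤ ∑ s, p s * (∑ n, π s n * (qb n - qbs n)
        + ∑ n, π s n * ((qp n + r s n) - (qps n + rs s n))) :=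
      Finset.sum_nonneg fun s _ => mul_nonneg (hp s).le (hprice s qb qp (r s) (h s))
    simp only [mul_add, Finset.sum_add_distrib] at h₁
    have hterm : ∀ s, p s * ∑ n, π s n * ((qp n + r s n) - (qps n + rs s n))
        ≤ p s * (P.frCost qp (r s) - P.frCost qps (rs s)) := fun s =>
      mul_le_mul_of_nonneg_left (hreg_le s qp (r s) (h s).2.1) (hp s).le
    have h₂ := Finset.sum_le_sum fun s (_ : s ∈ Finset.univ) => hterm s
    have h₃ := hbase_le qb (h s1).1
    have h₄ := hswap qb
    have h₅ := hle _ _ _ hopt.1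
    rw [P.sysCost_eq hpsum, P.sysCost_eq hpsum] at h₅
    simp only [mul_add, mul_sub, Finset.sum_add_distrib, Finset.sum_sub_distrib] at h₁ h₂ h₃ h₄ h₅
    have hq : ∀ s, qp + r s = qps + rs s := by
      intro s
      by_contra hne
      have := Finset.sum_lt_sum (fun s (_ : s ∈ Finset.univ) => hterm s) ⟨s, Finset.mem_univ s,
        mul_lt_mul_of_pos_left (hreg_lt s qp (r s) (h s).2.1 hne) (hp s)⟩
      simp only [mul_add, mul_sub, Finset.sum_add_distrib, Finset.sum_sub_distrib] at this
      linarith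
    have hqp : qp = qps := by simpa [hr1, hrs1] using hq s1
    refine ⟨?_, hqp, funext fun s => add_left_cancel (hqp ▸ hq s)⟩
    by_contra hne
    have := hbase_lt qb (h s1).1 hne
    simp only [mul_sub, Finset.sum_sub_distrib] at this
    linarith
  intro qb qp r _
  constructor
  · intro h
    obtain ⟨rfl, rfl, rfl⟩ := hsysUnique qb qp r h
    exact ⟨hedOpt, hfrOpt⟩
  · rintro ⟨hed, hfr⟩
    obtain ⟨rfl, rfl⟩ := hedUnique qb qp hed
    obtain rfl : r = rs := funext fun s => hfrUnique s _ (hfr s)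
    exact hopt
end
end

section
/- (Theorem 1(b).) Assume SYSTEM is feasible and that SYSTEM is optimally decomposed into ED–FR for the given δ (i.e., a tuple (qᵇ,qᵖ,(r_s)) with r_1 = 0 is optimal for SYSTEM if and only if (qᵇ,qᵖ) is optimal for ED(d_1) and each r_s is optimal for FR(qᵇ,qᵖ,d_s)). Let (qᵇ,qᵖ,(r_s)) be the optimal solution of SYSTEM and let (ξ̲, ξ̄, (ν̲_s, ν̄_s, μ̲_s, μ̄_s, λ_s)_{s∈S}) be any multipliers satisfying the KKT system of SYSTEM at it. Then for every node n with q̲ₙᵇ < qₙᵇ < q̄ₙᵇ and q̲ₙᵖ < qₙᵖ < q̄ₙᵖ, one has δ_n = Σ_{s∈S} p_s·(π_n(λ_s,μ̲_s,μ̄_s) − π_n(λ₁,μ̲₁,μ̄₁)). -/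
open Matrix Finset

noncomputable section

namespace PowerNet

variable {N L : ℕ} (P : PowerNet N L)

/-- Shifting `t` units of generation at node `n` from `qᵖ` to `qᵇ` leaves the injections
unchanged, hence preserves `Ω(d)` as long as the capacity bounds at `n` hold. -/
lemma Omega.shift {P : PowerNet N L} {d qb qp : Fin N → ℝ} (h : P.Omega d qb qp 0) {n : Fin N}
    {t : ℝ} (hb : P.qlb n ≤ qb n + t ∧ qb n + t ≤ P.qub n)
    (hq : P.plb n ≤ qp n - t ∧ qp n - t ≤ P.pub n) :
    P.Omega d (Function.update qb n (qb n + t)) (Function.update qp n (qp n - t)) 0 := by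
  obtain ⟨h1, h2, h3, h4⟩ := h
  have hinj : ∀ m, Function.update qb n (qb n + t) m + Function.update qp n (qp n - t) m
      + (0 : Fin N → ℝ) m - d m = qb m + qp m + (0 : Fin N → ℝ) m - d m := by
    intro m
    rcases eq_or_ne m n with rfl | hm
    · simp
    · simp [hm]
  refine ⟨fun m => ?_, fun m => ?_, ?_, ?_⟩
  · rcases eq_or_ne m n with rfl | hm
    · simpa using hb
    · simpa [hm] using h1 m
  · rcases eq_or_ne m n with rfl | hm
    · simpa using hq
    · simpa [hm] using h2 m
  · simpa only [hinj] using h3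
  · have : P.inj (Function.update qb n (qb n + t)) (Function.update qp n (qp n - t)) 0 d
        = P.inj qb qp 0 d := funext hinj
    simpa only [this] using h4

lemma edCost_shift (K : ℕ) (δ qb qp : Fin N → ℝ) (n : Fin N) (t : ℝ) :
    P.edCost K δ (Function.update qb n (qb n + t)) (Function.update qp n (qp n - t))
      = (K * P.cb n (qb n + t) + K * P.cp n (qp n - t) - δ n * (qb n + t))
        + ∑ m ∈ univ.erase n, (K * P.cb m (qb m) + K * P.cp m (qp m) - δ m * qb m) := by
  rw [edCost, ← Finset.add_sum_erase univ _ (mem_univ n)]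
  congr 1
  · simp
  · refine Finset.sum_congr rfl fun m hm => ?_
    simp [Finset.ne_of_mem_erase hm]

/-- At a node where no capacity bound binds, an optimal solution of ED satisfies
`δ = K·(cᵇ)′ − K·(cᵖ)′`. -/
lemma EDOpt.delta_eq {P : PowerNet N L} {K : ℕ} {δ d qb qp : Fin N → ℝ}
    (h : P.EDOpt K δ d qb qp) {n : Fin N}
    (hcb : HasDerivAt (P.cb n) (P.cb' n (qb n)) (qb n))
    (hcp : HasDerivAt (P.cp n) (P.cp' n (qp n)) (qp n))
    (hb : qb n ∈ Set.Ioo (P.qlb n) (P.qub n)) (hq : qp n ∈ Set.Ioo (P.plb n) (P.pub n)) :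
    δ n = K * P.cb' n (qb n) - K * P.cp' n (qp n) := by
  set g : ℝ → ℝ := fun t =>
    K * P.cb n (qb n + t) + K * P.cp n (qp n - t) - δ n * (qb n + t) with hg
  have hadd : HasDerivAt (fun t : ℝ => qb n + t) 1 0 := (hasDerivAt_id 0).const_add _
  have hsub : HasDerivAt (fun t : ℝ => qp n - t) (-1) 0 := (hasDerivAt_id 0).const_sub _
  have hbt : ∀ᶠ t in nhds (0 : ℝ), qb n + t ∈ Set.Ioo (P.qlb n) (P.qub n) :=
    hadd.continuousAt.eventually_mem (by simpa using Ioo_mem_nhds hb.1 hb.2)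
  have hqt : ∀ᶠ t in nhds (0 : ℝ), qp n - t ∈ Set.Ioo (P.plb n) (P.pub n) :=
    hsub.continuousAt.eventually_mem (by simpa using Ioo_mem_nhds hq.1 hq.2)
  have hmin : IsLocalMin g 0 := by
    filter_upwards [hbt, hqt] with t ht ht'
    have hle := h.2 _ _ (h.1.shift ⟨ht.1.le, ht.2.le⟩ ⟨ht'.1.le, ht'.2.le⟩)
    have h0 := P.edCost_shift K δ qb qp n 0
    simp only [add_zero, sub_zero, Function.update_eq_self] at h0
    rw [edCost_shift, h0] at hle
    simpa [hg] using hle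
  have hcb' : HasDerivAt (fun t => P.cb n (qb n + t)) (P.cb' n (qb n) * 1) 0 :=
    HasDerivAt.comp 0 (by simpa using hcb) hadd
  have hcp' : HasDerivAt (fun t => P.cp n (qp n - t)) (P.cp' n (qp n) * -1) 0 :=
    HasDerivAt.comp 0 (by simpa using hcp) hsub
  have hzero := hmin.hasDerivAt_eq_zero
    (((hcb'.const_mul (K : ℝ)).add (hcp'.const_mul (K : ℝ))).sub (hadd.const_mul (δ n)))
  linarith

end PowerNet

/-- Complementary slackness for box constraints: multipliers vanish where the bounds are strict. -/
lemma multipliers_eq_zero_of_slack {ι : Type*} [Fintype ι] {a b l u x : ι → ℝ}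
    (ha : ∀ i, 0 ≤ a i) (hb : ∀ i, 0 ≤ b i) (hx : ∀ i, l i ≤ x i ∧ x i ≤ u i)
    (hsum : ∑ i, (a i * (l i - x i) + b i * (x i - u i)) = 0)
    {i : ι} (hl : l i < x i) (hu : x i < u i) : a i = 0 ∧ b i = 0 := by
  have h1 : ∀ j, a j * (l j - x j) ≤ 0 := fun j =>
    mul_nonpos_of_nonneg_of_nonpos (ha j) (sub_nonpos.2 (hx j).1)
  have h2 : ∀ j, b j * (x j - u j) ≤ 0 := fun j =>
    mul_nonpos_of_nonneg_of_nonpos (hb j) (sub_nonpos.2 (hx j).2)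
  have hi := (Finset.sum_eq_zero_iff_of_nonpos fun j _ => add_nonpos (h1 j) (h2 j)).1 hsum i
    (mem_univ i)
  have ha0 : a i * (l i - x i) = 0 := by linarith [h1 i, h2 i]
  have hb0 : b i * (x i - u i) = 0 := by linarith [h1 i, h2 i]
  exact ⟨(mul_eq_zero.1 ha0).resolve_right (sub_neg.2 hl).ne,
    (mul_eq_zero.1 hb0).resolve_right (sub_neg.2 hu).ne⟩

/-- **Theorem 1(b).** Assume SYSTEM is feasible and that SYSTEM is
optimally decomposed into ED–FR for the given `δ`. Let `(qᵇ,qᵖ,(r_s))` be the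
optimal solution of SYSTEM and `(ξ̲,ξ̄,(ν̲_s,ν̄_s,μ̲_s,μ̄_s,λ_s))` any multipliers
satisfying the KKT system of SYSTEM at it. Then for every node `n` with
`q̲ₙᵇ < qₙᵇ < q̄ₙᵇ` and `q̲ₙᵖ < qₙᵖ < q̄ₙᵖ`, one has
`δ_n = ∑_s p_s (π_n(λ_s,μ̲_s,μ̄_s) − π_n(λ₁,μ̲₁,μ̄₁))`. -/
theorem decomposition_theorem_b
    {N L : ℕ} (P : PowerNet N L) (hP : P.Sane)
    {S : Type} [Fintype S] (s1 : S)
    (K : ℕ) (hK : 1 ≤ K)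
    (p : S → ℝ) (hp : ∀ s, 0 < p s) (hpsum : ∑ s, p s = (K : ℝ)) (hp1 : p s1 = 1)
    (d : S → Fin N → ℝ) (δ : Fin N → ℝ)
    (hfeas : ∃ qb qp r, P.SysFeas s1 d qb qp r)
    (hdec : ∀ (qb qp : Fin N → ℝ) (r : S → Fin N → ℝ), r s1 = 0 →
      (P.SysOpt s1 p d qb qp r ↔
        (P.EDOpt K δ (d s1) qb qp ∧ ∀ s, P.FROpt (d s) qb qp (r s))))
    (qb qp : Fin N → ℝ) (r : S → Fin N → ℝ)
    (hopt : P.SysOpt s1 p d qb qp r)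
    (ξl ξu : Fin N → ℝ) (νl νu : S → Fin N → ℝ)
    (μl μu : S → Fin L → ℝ) (lam : S → ℝ)
    (hkkt : P.SystemKKT K p d qb qp r ξl ξu νl νu μl μu lam) :
    ∀ n : Fin N,
      P.qlb n < qb n → qb n < P.qub n →
      P.plb n < qp n → qp n < P.pub n →
      δ n = ∑ s, p s * (P.price (lam s) (μl s) (μu s) n
                      - P.price (lam s1) (μl s1) (μu s1) n) := by
  intro n hbl hbu hpl hpu
  obtain ⟨-, -, -, -, -, hcb, hcp, -⟩ := hP
  obtain ⟨hξl, hξu, hνl, hνu, -, -, hstat_b, hslack_b, hstat_p, hslack_p, -⟩ := hkkt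
  obtain ⟨hΩ, hr⟩ := hopt.1
  have hδ := ((hdec qb qp r hr).1 hopt).1.delta_eq (hcb n _) (hcp n _) ⟨hbl, hbu⟩ ⟨hpl, hpu⟩
  obtain ⟨hξl0, hξu0⟩ := multipliers_eq_zero_of_slack hξl hξu (hΩ s1).1 hslack_b hbl hbu
  obtain ⟨hνl0, hνu0⟩ := multipliers_eq_zero_of_slack (x := fun m => qp m + r s1 m)
    (hνl s1) (hνu s1) (hΩ s1).2.1 (hslack_p s1) (i := n) (by simpa [hr] using hpl)
    (by simpa [hr] using hpu)
  have hb := hstat_b n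
  have hq := hstat_p s1 n
  simp only [hr, hξl0, hξu0, hνl0, hνu0, Pi.zero_apply, add_zero, sub_zero] at hb hq
  simp only [mul_sub, Finset.sum_sub_distrib, ← Finset.sum_mul, hpsum]
  rw [hδ, hb, hq]
end
end

section
/- (Proposition 1(i), frequency restoration.) Every optimal solution (r, ω, v, φ) of FR′(qᵇ,qᵖ,d_s) satisfies ω = 0. -/
open Matrix Finset

noncomputable section

/-- Data for the frequency-regulation problems `FR` and `FR′`: oriented
incidence matrix `C`, positive line susceptances `Bd`, line limits `f`,
capacity bounds for dispatch and regulation generators, regulation cost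
functions `cp` with derivatives `cp'`, damping coefficients `D`, and fixed
dispatch setpoints `qb`, regulation setpoints `qp`, and demand `d`. -/
structure FRNet (N L : ℕ) where
  C : Matrix (Fin N) (Fin L) ℝ
  Bd : Fin L → ℝ
  f : Fin L → ℝ
  qlb : Fin N → ℝ
  qub : Fin N → ℝ
  plb : Fin N → ℝ
  pub : Fin N → ℝ
  cp : Fin N → ℝ → ℝ
  cp' : Fin N → ℝ → ℝ
  D : Fin N → ℝ
  qb : Fin N → ℝ
  qp : Fin N → ℝ
  d : Fin N → ℝ

namespace FRNet

variable {N L : ℕ} (P : FRNet N L)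

/-- The weighted Laplacian `Lap = C·B·Cᵀ`. -/
def Lap : Matrix (Fin N) (Fin N) ℝ := P.C * Matrix.diagonal P.Bd * P.Cᵀ

/-- The shift-factor matrix `H = B·Cᵀ·(Lap + (1/N)·𝟙𝟙ᵀ)⁻¹`. -/
def H : Matrix (Fin L) (Fin N) ℝ :=
  Matrix.diagonal P.Bd * P.Cᵀ *
    (P.Lap + (N : ℝ)⁻¹ • Matrix.of (fun _ _ : Fin N => (1 : ℝ)))⁻¹

/-- Standing assumptions: `N ≥ 1`; positive susceptances; connectivity (the
kernel of `Cᵀ` is spanned by the all-ones vector); ordered capacity bounds;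
positive damping; regulation costs continuously differentiable (with the
indicated derivatives) and strictly convex. -/
def Sane : Prop :=
  1 ≤ N ∧
  (∀ l, 0 < P.Bd l) ∧
  (∀ x : Fin N → ℝ, P.Cᵀ.mulVec x = 0 → ∃ c : ℝ, x = fun _ => c) ∧
  (∀ n, P.qlb n ≤ P.qub n) ∧ (∀ n, P.plb n ≤ P.pub n) ∧
  (∀ n, 0 < P.D n) ∧
  (∀ n x, HasDerivAt (P.cp n) (P.cp' n x) x) ∧
  (∀ n, Continuous (P.cp' n)) ∧
  (∀ n, StrictConvexOn ℝ Set.univ (P.cp n))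

/-- Nodal injections `qᵇ + qᵖ + r − d`. -/
def inj (_P : FRNet N L) (qb qp r d : Fin N → ℝ) : Fin N → ℝ :=
  fun n => qb n + qp n + r n - d n

/-- The feasible set `Ω(d)` of `FR`. -/
def Omega (qb qp r : Fin N → ℝ) : Prop :=
  (∀ n, P.qlb n ≤ qb n ∧ qb n ≤ P.qub n) ∧
  (∀ n, P.plb n ≤ qp n + r n ∧ qp n + r n ≤ P.pub n) ∧
  (∑ n, (qb n + qp n + r n - P.d n) = 0) ∧
  (∀ l, -P.f l ≤ P.H.mulVec (P.inj qb qp r P.d) l ∧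
        P.H.mulVec (P.inj qb qp r P.d) l ≤ P.f l)

/-- The FR objective `∑_n cᵖ(qᵖ + r)`. -/
def frCost (r : Fin N → ℝ) : ℝ := ∑ n, P.cp n (P.qp n + r n)

/-- Optimality for `FR(qᵇ,qᵖ,d)`. -/
def FROpt (r : Fin N → ℝ) : Prop :=
  P.Omega P.qb P.qp r ∧ ∀ r', P.Omega P.qb P.qp r' → P.frCost r ≤ P.frCost r'

/-- Feasibility for `FR′(qᵇ,qᵖ,d)` at `(r, ω, v, φ)`:
`qᵇ+qᵖ+r−d−D·ω = C·v`, `qᵇ+qᵖ+r−d = Lap·φ`, `−f ≤ B·Cᵀφ ≤ f`, and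
`q̲ᵖ ≤ qᵖ + r ≤ q̄ᵖ`. -/
def FRpFeas (r ω : Fin N → ℝ) (v : Fin L → ℝ) (φ : Fin N → ℝ) : Prop :=
  (∀ n, P.qb n + P.qp n + r n - P.d n - P.D n * ω n = P.C.mulVec v n) ∧
  (∀ n, P.qb n + P.qp n + r n - P.d n = P.Lap.mulVec φ n) ∧
  (∀ l, -P.f l ≤ P.Bd l * P.Cᵀ.mulVec φ l ∧ P.Bd l * P.Cᵀ.mulVec φ l ≤ P.f l) ∧
  (∀ n, P.plb n ≤ P.qp n + r n ∧ P.qp n + r n ≤ P.pub n)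

/-- The `FR′` objective `∑_n (cᵖ(qᵖ + r) + D·ω²/2)`. -/
def frpCost (r ω : Fin N → ℝ) : ℝ :=
  ∑ n, (P.cp n (P.qp n + r n) + P.D n * ω n ^ 2 / 2)

/-- Optimality for `FR′(qᵇ,qᵖ,d)`. -/
def FRpOpt (r ω : Fin N → ℝ) (v : Fin L → ℝ) (φ : Fin N → ℝ) : Prop :=
  P.FRpFeas r ω v φ ∧
  ∀ r' ω' v' φ', P.FRpFeas r' ω' v' φ' → P.frpCost r ω ≤ P.frpCost r' ω'

end FRNet

/-- **Proposition 1(i), frequency restoration.** Every optimal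
solution `(r, ω, v, φ)` of `FR′(qᵇ,qᵖ,d_s)` satisfies `ω = 0`. -/
theorem frp_frequency_restoration
    {N L : ℕ} (P : FRNet N L) (hP : P.Sane)
    (r ω : Fin N → ℝ) (v : Fin L → ℝ) (φ : Fin N → ℝ)
    (hopt : P.FRpOpt r ω v φ) :
    ω = 0 := by
  obtain ⟨-, -, -, -, -, hD, -⟩ := hP
  obtain ⟨⟨-, hbal, hline, hcap⟩, hmin⟩ := hopt
  have hle : P.frpCost r ω ≤ P.frpCost r 0 := by
    refine hmin r 0 (Matrix.diagonal P.Bd *ᵥ (P.Cᵀ *ᵥ φ)) φ ⟨fun n => ?_, hbal, hline, hcap⟩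
    rw [Pi.zero_apply, mul_zero, sub_zero, hbal n, FRNet.Lap, Matrix.mulVec_mulVec,
      Matrix.mulVec_mulVec, Matrix.mul_assoc]
  have hnonneg : ∀ n ∈ Finset.univ, 0 ≤ P.D n * ω n ^ 2 / 2 := fun n _ => by
    have := hD n
    positivity
  have hsum : ∑ n, P.D n * ω n ^ 2 / 2 = 0 := by
    refine le_antisymm ?_ (Finset.sum_nonneg hnonneg)
    simpa [FRNet.frpCost, Finset.sum_add_distrib] using hle
  ext n
  have hn := (Finset.sum_eq_zero_iff_of_nonneg hnonneg).1 hsum n (Finset.mem_univ n)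
  simpa [(hD n).ne'] using hn
end
end

section
/- (Characterization of optimal supply-function bids.) Let c : (0,∞) → ℝ be differentiable and strictly convex, with derivative c′ a strictly increasing continuous bijection from (0,∞) onto ℝ; let 0 < a < b; let S be a finite nonempty index set with weights p_s > 0, prices π_s ∈ ℝ, and supply values σ_s ∈ ℝ for s ∈ S. For α > 0 define the expected profit PF(α) := Σ_{s∈S} p_s·(π_s·[α·σ_s]_a^b − c([α·σ_s]_a^b)). If α > 0 satisfies [α·σ_s]_a^b = [c′⁻¹(π_s)]_a^b for every s ∈ S, while ᾱ > 0 fails this condition for at least one s ∈ S, then PF(α) > PF(ᾱ). Consequently, if at least one α* > 0 satisfies the condition, then the maximizers of PF over (0,∞) are exactly those α > 0 that satisfy the condition. -/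
open Finset

/-- Clamp `x` to the interval `[a,b]`: `[x]_a^b = min (max x a) b`. -/
noncomputable def clamp (x a b : ℝ) : ℝ := min (max x a) b

theorem clamp_mem_Icc (x : ℝ) {a b : ℝ} (hab : a ≤ b) : clamp x a b ∈ Set.Icc a b :=
  ⟨le_min (le_max_right x a) hab, min_le_right _ _⟩

/-- A strictly convex function lies strictly above its tangent lines. -/
theorem StrictConvexOn.tangent_lt_s15 {D : Set ℝ} {f : ℝ → ℝ} {f' x y : ℝ}
    (hf : StrictConvexOn ℝ D f) (hx : x ∈ D) (hy : y ∈ D) (hxy : y ≠ x)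
    (hd : HasDerivAt f f' x) : f x + f' * (y - x) < f y := by
  rcases hxy.lt_or_gt with h | h
  · have := hf.slope_lt_of_hasDerivAt hy hx h hd
    rw [slope_def_field, div_lt_iff₀ (sub_pos.2 h)] at this
    linarith
  · have := hf.lt_slope_of_hasDerivAt hx hy h hd
    rw [slope_def_field, lt_div_iff₀ (sub_pos.2 h)] at this
    linarith

/-- Clamping an unconstrained stationary point `y` to `[a,b]` gives a point satisfying the
first-order optimality condition on `[a,b]`. -/
theorem sub_mul_sub_clamp_nonpos {f' : ℝ → ℝ} {D : Set ℝ} (hf' : MonotoneOn f' D)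
    {a b x y : ℝ} (ha : a ∈ D) (hb : b ∈ D) (hab : a ≤ b) (hy : y ∈ D)
    (hx : x ∈ Set.Icc a b) :
    (f' y - f' (clamp y a b)) * (x - clamp y a b) ≤ 0 := by
  rcases le_total y a with h | h
  · have hm : clamp y a b = a := by rw [clamp, max_eq_right h, min_eq_left hab]
    rw [hm]
    exact mul_nonpos_of_nonpos_of_nonneg (sub_nonpos.2 (hf' hy ha h)) (sub_nonneg.2 hx.1)
  rcases le_total b y with h' | h'
  · have hm : clamp y a b = b := by rw [clamp, max_eq_left h, min_eq_right h']
    rw [hm]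
    exact mul_nonpos_of_nonneg_of_nonpos (sub_nonneg.2 (hf' hb hy h')) (sub_nonpos.2 hx.2)
  · have hm : clamp y a b = y := by rw [clamp, max_eq_left h, min_eq_left h']
    simp [hm]

/-- The clamped stationary point is the unique profit maximizer on `[a,b]`. -/
theorem profit_lt_profit_clamp {c c' : ℝ → ℝ}
    (hderiv : ∀ x ∈ Set.Ioi (0 : ℝ), HasDerivAt c (c' x) x)
    (hconv : StrictConvexOn ℝ (Set.Ioi 0) c) (hmono : MonotoneOn c' (Set.Ioi 0))
    {a b x y : ℝ} (ha : 0 < a) (hab : a ≤ b) (hy : 0 < y) (hx : x ∈ Set.Icc a b)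
    (hne : x ≠ clamp y a b) :
    c' y * x - c x < c' y * clamp y a b - c (clamp y a b) := by
  have hm : clamp y a b ∈ Set.Ioi (0 : ℝ) := ha.trans_le (clamp_mem_Icc y hab).1
  have hxpos : x ∈ Set.Ioi (0 : ℝ) := ha.trans_le hx.1
  have htangent := hconv.tangent_lt_s15 hm hxpos hne (hderiv _ hm)
  have hfirst := sub_mul_sub_clamp_nonpos hmono ha (ha.trans_le hab) hab hy hx
  linarith

/-- **characterization of optimal supply-function bids.**
Let `c : (0,∞) → ℝ` be differentiable and strictly convex with derivative `c'`
a strictly increasing continuous bijection from `(0,∞)` onto `ℝ` (with inverse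
`cInv`), let `0 < a < b`, and consider finitely many outcomes with weights
`p_s > 0`, prices `π_s`, and supply values `σ_s`. With expected profit
`PF(α) = ∑_s p_s (π_s·[α σ_s]_a^b − c([α σ_s]_a^b))`: any `α > 0` with
`[α σ_s]_a^b = [cInv(π_s)]_a^b` for every `s` yields strictly larger profit
than any `ᾱ > 0` failing this condition; consequently, if some `α* > 0`
satisfies the condition, the maximizers of `PF` over `(0,∞)` are exactly the
`α > 0` satisfying it. -/
theorem supply_function_bid_characterization
    (c c' cInv : ℝ → ℝ)
    (hderiv : ∀ x ∈ Set.Ioi (0 : ℝ), HasDerivAt c (c' x) x)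
    (hconv : StrictConvexOn ℝ (Set.Ioi 0) c)
    (hmono : StrictMonoOn c' (Set.Ioi 0))
    (hcont : ContinuousOn c' (Set.Ioi 0))
    (hInvMem : ∀ y : ℝ, cInv y ∈ Set.Ioi (0 : ℝ))
    (hInvR : ∀ y : ℝ, c' (cInv y) = y)
    (hInvL : ∀ x ∈ Set.Ioi (0 : ℝ), cInv (c' x) = x)
    (a b : ℝ) (ha : 0 < a) (hab : a < b)
    (S : Type) [Fintype S] [Nonempty S]
    (p : S → ℝ) (hp : ∀ s, 0 < p s) (π : S → ℝ) (σ : S → ℝ) :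
    (∀ α : ℝ, 0 < α →
      (∀ s, clamp (α * σ s) a b = clamp (cInv (π s)) a b) →
      ∀ β : ℝ, 0 < β →
        (¬ ∀ s, clamp (β * σ s) a b = clamp (cInv (π s)) a b) →
        ∑ s, p s * (π s * clamp (β * σ s) a b - c (clamp (β * σ s) a b)) <
        ∑ s, p s * (π s * clamp (α * σ s) a b - c (clamp (α * σ s) a b))) ∧
    ((∃ α : ℝ, 0 < α ∧ ∀ s, clamp (α * σ s) a b = clamp (cInv (π s)) a b) →
      ∀ α : ℝ, 0 < α →
        ((∀ β : ℝ, 0 < β →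
          ∑ s, p s * (π s * clamp (β * σ s) a b - c (clamp (β * σ s) a b)) ≤
          ∑ s, p s * (π s * clamp (α * σ s) a b - c (clamp (α * σ s) a b))) ↔
        (∀ s, clamp (α * σ s) a b = clamp (cInv (π s)) a b))) := by
  have hpoint : ∀ β s, clamp (β * σ s) a b ≠ clamp (cInv (π s)) a b →
      p s * (π s * clamp (β * σ s) a b - c (clamp (β * σ s) a b)) <
      p s * (π s * clamp (cInv (π s)) a b - c (clamp (cInv (π s)) a b)) := by
    intro β s hne
    have h := profit_lt_profit_clamp hderiv hconv hmono.monotoneOn ha hab.le (hInvMem (π s))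
      (clamp_mem_Icc (β * σ s) hab.le) hne
    rw [hInvR] at h
    exact mul_lt_mul_of_pos_left h (hp s)
  have hstrict : ∀ α : ℝ, 0 < α →
      (∀ s, clamp (α * σ s) a b = clamp (cInv (π s)) a b) →
      ∀ β : ℝ, 0 < β →
        (¬ ∀ s, clamp (β * σ s) a b = clamp (cInv (π s)) a b) →
        ∑ s, p s * (π s * clamp (β * σ s) a b - c (clamp (β * σ s) a b)) <
        ∑ s, p s * (π s * clamp (α * σ s) a b - c (clamp (α * σ s) a b)) := by
    intro α _ hα β _ hβ
    simp only [hα]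
    obtain ⟨t, ht⟩ := not_forall.1 hβ
    refine Finset.sum_lt_sum (fun s _ => ?_) ⟨t, Finset.mem_univ t, hpoint β t ht⟩
    by_cases hs : clamp (β * σ s) a b = clamp (cInv (π s)) a b
    · rw [hs]
    · exact (hpoint β s hs).le
  refine ⟨hstrict, ?_⟩
  rintro ⟨γ, hγ, hγopt⟩ α hα
  constructor
  · intro hmax
    by_contra hfail
    exact (hstrict γ hγ hγopt α hα hfail).not_ge (hmax γ hγ)
  · intro hopt β hβ
    by_cases h : ∀ s, clamp (β * σ s) a b = clamp (cInv (π s)) a b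
    · simp only [h, hopt, le_refl]
    · exact (hstrict α hα hopt β hβ h).le
end
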